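/- Normalization for the simply typed λ-calculus with V-valued global state: fix a finite set V = {v₁,…,v_k}. Every term of the STLC extended with operators get(t₁,…,t_k) : b (with k arguments of base type) and put_{v_i}(t) : b (one argument of base type) is equal, modulo the congruence generated by βη-equality and the global-state equations get(put_{v₁}(t),…,put_{v_k}(t)) ≈ t, put_{v_i}(get(t₁,…,t_k)) ≈ put_{v_i}(t_i), and put_{v_i}(put_{v_j}(t)) ≈ put_{v_j}(t), to a term in normal form, where normal and neutral forms are defined mutually inductively: variables are neutral; app f a is neutral if f is neutral and a is normal; get(put_{w₁}(t₁),…,put_{w_k}(t_k)) is normal of base type whenever each t_i is neutral of base type and w₁,…,w_k ∈ V; and λx:A. t is normal if t is normal. -/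

import Mathlib

/-- Simple types: freely generated by a base type and function types. -/
inductive Ty : Type
  | base : Ty
  | arrow : Ty → Ty → Ty

/-- Terms of the STLC extended with `V`-valued global state: `get` takes one argument of base
type for each value in `V`, and `put v` one argument of base type. -/
inductive TmG (V : Type) : List Ty → Ty → Type
  | var : {Γ : List Ty} → (i : Fin Γ.length) → TmG V Γ (Γ.get i)
  | app : {Γ : List Ty} → {A B : Ty} → TmG V Γ (Ty.arrow A B) → TmG V Γ A → TmG V Γ B
  | lam : {Γ : List Ty} → {A B : Ty} → TmG V (A :: Γ) B → TmG V Γ (Ty.arrow A B)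
  | get : {Γ : List Ty} → (V → TmG V Γ Ty.base) → TmG V Γ Ty.base
  | put : {Γ : List Ty} → V → TmG V Γ Ty.base → TmG V Γ Ty.base

/-- Variable renamings. -/
def RenG (Δ Γ : List Ty) : Type :=
  (i : Fin Γ.length) → { j : Fin Δ.length // Δ.get j = Γ.get i }

def RenG.lift {Δ Γ : List Ty} (ρ : RenG Δ Γ) (A : Ty) : RenG (A :: Δ) (A :: Γ) := fun i =>
  Fin.cases ⟨⟨0, by simp⟩, rfl⟩ (fun i' => ⟨(ρ i').1.succ, (ρ i').2⟩) i

def RenG.up (Δ : List Ty) (A : Ty) : RenG (A :: Δ) Δ := fun i => ⟨i.succ, rfl⟩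

def TmG.rename {V : Type} : {Γ Δ : List Ty} → {A : Ty} → TmG V Γ A → RenG Δ Γ → TmG V Δ A
  | _, _, _, TmG.var i, ρ => (ρ i).2 ▸ TmG.var (ρ i).1
  | _, _, _, TmG.app f a, ρ => TmG.app (f.rename ρ) (a.rename ρ)
  | _, _, _, TmG.lam t, ρ => TmG.lam (t.rename (ρ.lift _))
  | _, _, _, TmG.get ts, ρ => TmG.get (fun v => (ts v).rename ρ)
  | _, _, _, TmG.put v t, ρ => TmG.put v (t.rename ρ)

/-- Simultaneous substitutions. -/
def SbG (V : Type) (Δ Γ : List Ty) : Type := (i : Fin Γ.length) → TmG V Δ (Γ.get i)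

def SbG.lift {V : Type} {Δ Γ : List Ty} (σ : SbG V Δ Γ) (A : Ty) : SbG V (A :: Δ) (A :: Γ) :=
  fun i => Fin.cases (TmG.var ⟨0, by simp⟩) (fun i' => (σ i').rename (RenG.up Δ A)) i

def TmG.subst {V : Type} : {Γ Δ : List Ty} → {A : Ty} → TmG V Γ A → SbG V Δ Γ → TmG V Δ A
  | _, _, _, TmG.var i, σ => σ i
  | _, _, _, TmG.app f a, σ => TmG.app (f.subst σ) (a.subst σ)
  | _, _, _, TmG.lam t, σ => TmG.lam (t.subst (σ.lift _))
  | _, _, _, TmG.get ts, σ => TmG.get (fun v => (ts v).subst σ)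
  | _, _, _, TmG.put v t, σ => TmG.put v (t.subst σ)

def SbG.single {V : Type} {Γ : List Ty} {A : Ty} (u : TmG V Γ A) : SbG V Γ (A :: Γ) :=
  fun i => Fin.cases u (fun i' => TmG.var i') i

/-- The congruence generated by βη-equality and the global-state equations. -/
inductive EqG {V : Type} : {Γ : List Ty} → {A : Ty} → TmG V Γ A → TmG V Γ A → Prop
  | refl {Γ : List Ty} {A : Ty} {t : TmG V Γ A} : EqG t t
  | symm {Γ : List Ty} {A : Ty} {t u : TmG V Γ A} : EqG t u → EqG u t
  | trans {Γ : List Ty} {A : Ty} {t u v : TmG V Γ A} : EqG t u → EqG u v → EqG t v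
  | congApp {Γ : List Ty} {A B : Ty} {f f' : TmG V Γ (Ty.arrow A B)} {a a' : TmG V Γ A} :
      EqG f f' → EqG a a' → EqG (TmG.app f a) (TmG.app f' a')
  | congLam {Γ : List Ty} {A B : Ty} {t t' : TmG V (A :: Γ) B} :
      EqG t t' → EqG (TmG.lam t) (TmG.lam t')
  | congGet {Γ : List Ty} {ts us : V → TmG V Γ Ty.base} :
      (∀ v, EqG (ts v) (us v)) → EqG (TmG.get ts) (TmG.get us)
  | congPut {Γ : List Ty} (v : V) {t t' : TmG V Γ Ty.base} :
      EqG t t' → EqG (TmG.put v t) (TmG.put v t')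
  | beta {Γ : List Ty} {A B : Ty} (t : TmG V (A :: Γ) B) (u : TmG V Γ A) :
      EqG (TmG.app (TmG.lam t) u) (t.subst (SbG.single u))
  | eta {Γ : List Ty} {A B : Ty} (t : TmG V Γ (Ty.arrow A B)) :
      EqG t (TmG.lam (TmG.app (t.rename (RenG.up Γ A)) (TmG.var ⟨0, by simp⟩)))
  | getPut {Γ : List Ty} (t : TmG V Γ Ty.base) :
      EqG (TmG.get (fun v => TmG.put v t)) t
  | putGet {Γ : List Ty} (v : V) (ts : V → TmG V Γ Ty.base) :
      EqG (TmG.put v (TmG.get ts)) (TmG.put v (ts v))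
  | putPut {Γ : List Ty} (v w : V) (t : TmG V Γ Ty.base) :
      EqG (TmG.put v (TmG.put w t)) (TmG.put w t)

mutual
  /-- Normal forms for the STLC with global state. -/
  inductive NormalG {V : Type} : {Γ : List Ty} → {A : Ty} → TmG V Γ A → Prop
    | get {Γ : List Ty} (w : V → V) {ts : V → TmG V Γ Ty.base} :
        (∀ v, NeutralG (ts v)) → NormalG (TmG.get (fun v => TmG.put (w v) (ts v)))
    | lam {Γ : List Ty} {A B : Ty} {t : TmG V (A :: Γ) B} : NormalG t → NormalG (TmG.lam t)
  /-- Neutral forms for the STLC with global state. -/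
  inductive NeutralG {V : Type} : {Γ : List Ty} → {A : Ty} → TmG V Γ A → Prop
    | var {Γ : List Ty} (i : Fin Γ.length) : NeutralG (TmG.var i)
    | app {Γ : List Ty} {A B : Ty} {f : TmG V Γ (Ty.arrow A B)} {a : TmG V Γ A} :
        NeutralG f → NormalG a → NeutralG (TmG.app f a)
end

section

variable {V : Type}

namespace RenG

/-- Composition of renamings. -/
def comp {Θ Δ Γ : List Ty} (ρ : RenG Δ Γ) (θ : RenG Θ Δ) : RenG Θ Γ := fun i =>
  ⟨(θ (ρ i).1).1, (θ (ρ i).1).2.trans (ρ i).2⟩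

/-- The identity renaming. -/
def id (Γ : List Ty) : RenG Γ Γ := fun i => ⟨i, rfl⟩

theorem lift_comp {Θ Δ Γ : List Ty} (ρ : RenG Δ Γ) (θ : RenG Θ Δ) (A : Ty) :
    (ρ.lift A).comp (θ.lift A) = (ρ.comp θ).lift A := by
  funext i
  refine Fin.cases ?_ (fun j => ?_) i <;> rfl

theorem lift_id (Γ : List Ty) (A : Ty) : (id Γ).lift A = id (A :: Γ) := by
  funext i
  refine Fin.cases ?_ (fun j => ?_) i <;> rfl

end RenG

namespace SbG

/-- Precomposition of a substitution with a renaming. -/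
def precomp {Θ Δ Γ : List Ty} (ρ : RenG Δ Γ) (σ : SbG V Θ Δ) : SbG V Θ Γ := fun i =>
  (ρ i).2 ▸ σ (ρ i).1

/-- Postcomposition of a substitution with a renaming. -/
def rename {Θ Δ Γ : List Ty} (σ : SbG V Δ Γ) (ρ : RenG Θ Δ) : SbG V Θ Γ := fun i =>
  (σ i).rename ρ

/-- Composition of substitutions. -/
def comp {Θ Δ Γ : List Ty} (σ : SbG V Δ Γ) (τ : SbG V Θ Δ) : SbG V Θ Γ := fun i =>
  (σ i).subst τ

/-- The identity substitution. -/
def id (Γ : List Ty) : SbG V Γ Γ := fun i => TmG.var i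

/-- Extension of a substitution by a term for the last variable. -/
def cons {Δ Γ : List Ty} {A : Ty} (σ : SbG V Δ Γ) (u : TmG V Δ A) : SbG V Δ (A :: Γ) :=
  fun i => Fin.cases u (fun j => σ j) i

end SbG

namespace TmG

theorem rename_cast {Γ Δ : List Ty} {A B : Ty} (h : A = B) (t : TmG V Γ A) (ρ : RenG Δ Γ) :
    (h ▸ t : TmG V Γ B).rename ρ = h ▸ t.rename ρ := by
  subst h; rfl

theorem subst_cast {Γ Δ : List Ty} {A B : Ty} (h : A = B) (t : TmG V Γ A) (σ : SbG V Δ Γ) :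
    (h ▸ t : TmG V Γ B).subst σ = h ▸ t.subst σ := by
  subst h; rfl

theorem cast_cast {Γ : List Ty} {A B C : Ty} (h : A = B) (h' : B = C) (t : TmG V Γ A) :
    (h' ▸ (h ▸ t : TmG V Γ B) : TmG V Γ C) = (h.trans h') ▸ t := by
  subst h; rfl

theorem rename_rename {Γ : List Ty} {A : Ty} (t : TmG V Γ A) :
    ∀ {Δ Θ : List Ty} (ρ : RenG Δ Γ) (θ : RenG Θ Δ),
      (t.rename ρ).rename θ = t.rename (ρ.comp θ) := by
  induction t with
  | var i => intro Δ Θ ρ θ; simp only [rename, rename_cast, cast_cast]; rfl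
  | app f a hf ha => intro Δ Θ ρ θ; simp only [rename, hf, ha]
  | lam t ht => intro Δ Θ ρ θ; simp only [rename, ht, RenG.lift_comp]
  | get ts hts => intro Δ Θ ρ θ; simp only [rename, hts]
  | put v t ht => intro Δ Θ ρ θ; simp only [rename, ht]

theorem rename_lift_rename_up {Γ Δ : List Ty} {A B : Ty} (t : TmG V Γ B) (ρ : RenG Δ Γ) :
    (t.rename (RenG.up Γ A)).rename (ρ.lift A) = (t.rename ρ).rename (RenG.up Δ A) :=
  (t.rename_rename (RenG.up Γ A) (ρ.lift A)).trans (t.rename_rename ρ (RenG.up Δ A)).symm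

theorem rename_id {Γ : List Ty} {A : Ty} (t : TmG V Γ A) : t.rename (RenG.id Γ) = t := by
  induction t with
  | var i => rfl
  | app f a hf ha => simp only [rename, hf, ha]
  | lam t ht => simp only [rename, RenG.lift_id, ht]
  | get ts hts => simp only [rename, hts]
  | put v t ht => simp only [rename, ht]

end TmG

namespace SbG

theorem lift_precomp {Θ Δ Γ : List Ty} (ρ : RenG Δ Γ) (σ : SbG V Θ Δ) (A : Ty) :
    precomp (ρ.lift A) (σ.lift A) = (precomp ρ σ).lift A := by
  funext i
  refine Fin.cases rfl (fun j => ?_) i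
  exact (TmG.rename_cast (ρ j).2 (σ (ρ j).1) (RenG.up Θ A)).symm

theorem lift_rename {Θ Δ Γ : List Ty} (σ : SbG V Δ Γ) (ρ : RenG Θ Δ) (A : Ty) :
    (σ.lift A).rename (ρ.lift A) = (σ.rename ρ).lift A := by
  funext i
  refine Fin.cases rfl (fun j => ?_) i
  exact (σ j).rename_lift_rename_up ρ

theorem lift_id (Γ : List Ty) (A : Ty) : (id Γ : SbG V Γ Γ).lift A = id (A :: Γ) := by
  funext i
  refine Fin.cases ?_ (fun j => ?_) i <;> rfl

end SbG

namespace TmG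

theorem subst_rename {Γ : List Ty} {A : Ty} (t : TmG V Γ A) :
    ∀ {Δ Θ : List Ty} (σ : SbG V Δ Γ) (ρ : RenG Θ Δ),
      (t.subst σ).rename ρ = t.subst (σ.rename ρ) := by
  induction t with
  | var i => intro Δ Θ σ ρ; rfl
  | app f a hf ha => intro Δ Θ σ ρ; simp only [rename, subst, hf, ha]
  | lam t ht => intro Δ Θ σ ρ; simp only [rename, subst, ht, SbG.lift_rename]
  | get ts hts => intro Δ Θ σ ρ; simp only [rename, subst, hts]
  | put v t ht => intro Δ Θ σ ρ; simp only [rename, subst, ht]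

theorem rename_subst {Γ : List Ty} {A : Ty} (t : TmG V Γ A) :
    ∀ {Δ Θ : List Ty} (ρ : RenG Δ Γ) (σ : SbG V Θ Δ),
      (t.rename ρ).subst σ = t.subst (SbG.precomp ρ σ) := by
  induction t with
  | var i => intro Δ Θ ρ σ; simp only [rename, subst, subst_cast]; rfl
  | app f a hf ha => intro Δ Θ ρ σ; simp only [rename, subst, hf, ha]
  | lam t ht => intro Δ Θ ρ σ; simp only [rename, subst, ht, SbG.lift_precomp]
  | get ts hts => intro Δ Θ ρ σ; simp only [rename, subst, hts]
  | put v t ht => intro Δ Θ ρ σ; simp only [rename, subst, ht]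

theorem subst_id {Γ : List Ty} {A : Ty} (t : TmG V Γ A) : t.subst (SbG.id Γ) = t := by
  induction t with
  | var i => rfl
  | app f a hf ha => simp only [subst, hf, ha]
  | lam t ht => simp only [subst, SbG.lift_id, ht]
  | get ts hts => simp only [subst, hts]
  | put v t ht => simp only [subst, ht]

end TmG

theorem SbG.lift_comp {Θ Δ Γ : List Ty} (σ : SbG V Δ Γ) (τ : SbG V Θ Δ) (A : Ty) :
    (σ.lift A).comp (τ.lift A) = (σ.comp τ).lift A := by
  funext i
  refine Fin.cases rfl (fun j => ?_) i
  exact (TmG.rename_subst (σ j) (RenG.up Δ A) (τ.lift A)).trans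
    (TmG.subst_rename (σ j) τ (RenG.up Θ A)).symm

theorem TmG.subst_subst {Γ : List Ty} {A : Ty} (t : TmG V Γ A) :
    ∀ {Δ Θ : List Ty} (σ : SbG V Δ Γ) (τ : SbG V Θ Δ),
      (t.subst σ).subst τ = t.subst (σ.comp τ) := by
  induction t with
  | var i => intro Δ Θ σ τ; rfl
  | app f a hf ha => intro Δ Θ σ τ; simp only [subst, hf, ha]
  | lam t ht => intro Δ Θ σ τ; simp only [subst, ht, SbG.lift_comp]
  | get ts hts => intro Δ Θ σ τ; simp only [subst, hts]
  | put v t ht => intro Δ Θ σ τ; simp only [subst, ht]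

theorem SbG.lift_comp_single {Δ Γ : List Ty} {A : Ty} (σ : SbG V Δ Γ) (u : TmG V Δ A) :
    (σ.lift A).comp (SbG.single u) = σ.cons u := by
  funext i
  refine Fin.cases rfl (fun j => ?_) i
  exact (TmG.rename_subst (σ j) (RenG.up Δ A) (SbG.single u)).trans (TmG.subst_id (σ j))

theorem TmG.rename_subst_single {Γ Δ : List Ty} {A B : Ty} (t : TmG V (A :: Γ) B)
    (u : TmG V Γ A) (ρ : RenG Δ Γ) :
    (t.subst (SbG.single u)).rename ρ = (t.rename (ρ.lift A)).subst (SbG.single (u.rename ρ)) := by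
  rw [TmG.subst_rename, TmG.rename_subst]
  congr 1
  funext i
  refine Fin.cases ?_ (fun j => ?_) i <;> rfl

theorem EqG.rename {Γ : List Ty} {A : Ty} {t u : TmG V Γ A} (h : EqG t u) :
    ∀ {Δ : List Ty} (ρ : RenG Δ Γ), EqG (t.rename ρ) (u.rename ρ) := by
  induction h with
  | refl => intro Δ ρ; exact .refl
  | symm _ ih => intro Δ ρ; exact (ih ρ).symm
  | trans _ _ ih ih' => intro Δ ρ; exact (ih ρ).trans (ih' ρ)
  | congApp _ _ ih ih' => intro Δ ρ; exact .congApp (ih ρ) (ih' ρ)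
  | congLam _ ih => intro Δ ρ; exact .congLam (ih _)
  | congGet _ ih => intro Δ ρ; exact .congGet fun v => ih v ρ
  | congPut v _ ih => intro Δ ρ; exact .congPut v (ih ρ)
  | beta t u => intro Δ ρ; rw [TmG.rename_subst_single]; exact .beta _ _
  | eta t =>
    intro Δ ρ
    simp only [TmG.rename]
    rw [TmG.rename_lift_rename_up]
    exact .eta _
  | getPut t => intro Δ ρ; exact .getPut _
  | putGet v ts => intro Δ ρ; exact .putGet v _
  | putPut v w t => intro Δ ρ; exact .putPut v w _

theorem NeutralG.cast {Γ : List Ty} {A B : Ty} (h : A = B) {t : TmG V Γ A} (ht : NeutralG t) :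
    NeutralG (h ▸ t : TmG V Γ B) := by
  subst h; exact ht

mutual

theorem NormalG.rename {Γ Δ : List Ty} {A : Ty} {t : TmG V Γ A} :
    NormalG t → ∀ ρ : RenG Δ Γ, NormalG (t.rename ρ)
  | .get w hts, ρ => .get w fun v => (hts v).rename ρ
  | .lam ht, ρ => .lam (ht.rename (ρ.lift _))

theorem NeutralG.rename {Γ Δ : List Ty} {A : Ty} {t : TmG V Γ A} :
    NeutralG t → ∀ ρ : RenG Δ Γ, NeutralG (t.rename ρ)
  | .var i, ρ => .cast (ρ i).2 (.var (ρ i).1)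
  | .app hf ha, ρ => .app (hf.rename ρ) (ha.rename ρ)

end

/-- A term has a normal form. -/
def HasNormalForm {Γ : List Ty} {A : Ty} (t : TmG V Γ A) : Prop :=
  ∃ n : TmG V Γ A, NormalG n ∧ EqG t n

theorem NeutralG.hasNormalForm {Γ : List Ty} {t : TmG V Γ Ty.base} (ht : NeutralG t) :
    HasNormalForm t :=
  ⟨_, .get _root_.id fun _ => ht, (EqG.getPut t).symm⟩

theorem NormalG.exists_eq_get {Γ : List Ty} {n : TmG V Γ Ty.base} (hn : NormalG n) :
    ∃ (w : V → V) (ts : V → TmG V Γ Ty.base),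
      (∀ v, NeutralG (ts v)) ∧ n = TmG.get fun v => TmG.put (w v) (ts v) := by
  cases hn with
  | get w hts => exact ⟨w, _, hts, rfl⟩

/-- Running a term that has a normal form from a known state yields a final state and a neutral
term. -/
theorem HasNormalForm.exists_put_eq {Γ : List Ty} {t : TmG V Γ Ty.base} (ht : HasNormalForm t)
    (v : V) : ∃ (w : V) (n : TmG V Γ Ty.base),
      NeutralG n ∧ EqG (TmG.put v t) (TmG.put w n) := by
  obtain ⟨_, hn, htn⟩ := ht
  obtain ⟨w, ts, hts, rfl⟩ := hn.exists_eq_get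
  exact ⟨w v, ts v, hts v, (EqG.congPut v htn).trans ((EqG.putGet v _).trans (.putPut v _ _))⟩

theorem HasNormalForm.of_put {Γ : List Ty} {t : TmG V Γ Ty.base}
    (h : ∀ v, ∃ (w : V) (n : TmG V Γ Ty.base), NeutralG n ∧ EqG (TmG.put v t) (TmG.put w n)) :
    HasNormalForm t := by
  choose w n hn htn using h
  exact ⟨_, .get w hn, (EqG.getPut t).symm.trans (.congGet htn)⟩

theorem HasNormalForm.get {Γ : List Ty} {ts : V → TmG V Γ Ty.base}
    (hts : ∀ v, HasNormalForm (ts v)) : HasNormalForm (TmG.get ts) :=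
  .of_put fun v =>
    let ⟨w, n, hn, h⟩ := (hts v).exists_put_eq v
    ⟨w, n, hn, (EqG.putGet v ts).trans h⟩

theorem HasNormalForm.put {Γ : List Ty} {t : TmG V Γ Ty.base} (ht : HasNormalForm t) (v : V) :
    HasNormalForm (TmG.put v t) :=
  .of_put fun u =>
    let ⟨w, n, hn, h⟩ := ht.exists_put_eq v
    ⟨w, n, hn, (EqG.putPut u v t).trans h⟩

/-- The Kripke logical predicate of reducible terms. -/
def Reducible : (A : Ty) → {Γ : List Ty} → TmG V Γ A → Prop
  | .base, _, t => HasNormalForm t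
  | .arrow A B, Γ, t => ∀ (Δ : List Ty) (ρ : RenG Δ Γ) (u : TmG V Δ A),
      Reducible A u → Reducible B (TmG.app (t.rename ρ) u)

namespace Reducible

theorem of_eqG : ∀ {A : Ty} {Γ : List Ty} {t u : TmG V Γ A},
    EqG t u → Reducible A u → Reducible A t
  | .base, _, _, _, h, ⟨n, hn, hun⟩ => ⟨n, hn, h.trans hun⟩
  | .arrow _ _, _, _, _, h, hu => fun Δ ρ a ha =>
      of_eqG (.congApp (h.rename ρ) .refl) (hu Δ ρ a ha)

theorem rename {A : Ty} {Γ Δ : List Ty} {t : TmG V Γ A} (ht : Reducible A t) (ρ : RenG Δ Γ) :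
    Reducible A (t.rename ρ) := by
  cases A with
  | base =>
    obtain ⟨n, hn, htn⟩ := ht
    exact ⟨n.rename ρ, hn.rename ρ, htn.rename ρ⟩
  | arrow A B =>
    intro Θ θ a ha
    rw [TmG.rename_rename]
    exact ht Θ _ a ha

theorem of_neutralG_and_hasNormalForm (A : Ty) :
    (∀ {Γ : List Ty} {t : TmG V Γ A}, NeutralG t → Reducible A t) ∧
      ∀ {Γ : List Ty} {t : TmG V Γ A}, Reducible A t → HasNormalForm t := by
  induction A with
  | base => exact ⟨fun ht => ht.hasNormalForm, fun ht => ht⟩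
  | arrow A B ihA ihB =>
    refine ⟨fun {Γ t} ht Δ ρ a ha => ?_, fun {Γ t} ht => ?_⟩
    · obtain ⟨n, hn, han⟩ := ihA.2 ha
      exact of_eqG (.congApp .refl han) (ihB.1 (.app (ht.rename ρ) hn))
    · obtain ⟨n, hn, htn⟩ := ihB.2 (ht (A :: Γ) (RenG.up Γ A) (TmG.var ⟨0, by simp⟩)
        (ihA.1 (.var (Γ := A :: Γ) ⟨0, by simp⟩)))
      exact ⟨_, .lam hn, (EqG.eta t).trans (.congLam htn)⟩

theorem of_neutralG {A : Ty} {Γ : List Ty} {t : TmG V Γ A} (ht : NeutralG t) : Reducible A t :=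
  (of_neutralG_and_hasNormalForm A).1 ht

theorem hasNormalForm {A : Ty} {Γ : List Ty} {t : TmG V Γ A} (ht : Reducible A t) :
    HasNormalForm t :=
  (of_neutralG_and_hasNormalForm A).2 ht

/-- The fundamental lemma: reducible substitutions preserve reducibility. -/
theorem subst {A : Ty} {Γ : List Ty} (t : TmG V Γ A) :
    ∀ {Δ : List Ty} (σ : SbG V Δ Γ), (∀ i, Reducible (Γ.get i) (σ i)) →
      Reducible A (t.subst σ) := by
  induction t with
  | var i => intro Δ σ hσ; exact hσ i
  | app f a hf ha =>
    intro Δ σ hσ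
    have h := hf σ hσ Δ (RenG.id Δ) _ (ha σ hσ)
    rwa [TmG.rename_id] at h
  | lam t ht =>
    intro Δ σ hσ Θ ρ u hu
    simp only [TmG.subst, TmG.rename]
    refine of_eqG (.beta _ _) ?_
    rw [TmG.subst_rename, SbG.lift_rename, TmG.subst_subst, SbG.lift_comp_single]
    exact ht _ (Fin.cases hu fun j => (hσ j).rename ρ)
  | get ts hts => intro Δ σ hσ; exact HasNormalForm.get fun v => hts v σ hσ
  | put v t ht => intro Δ σ hσ; exact HasNormalForm.put (ht σ hσ) v

end Reducible

end

/-- Normalization for the STLC with `V`-valued global state: every term is equal, modulo the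
congruence generated by βη and the global-state equations, to a term in normal form. -/
theorem global_state_normalization {V : Type} [Fintype V] (Γ : List Ty) (A : Ty)
    (t : TmG V Γ A) : ∃ n : TmG V Γ A, NormalG n ∧ EqG t n := by
  have h := Reducible.subst t (SbG.id Γ) fun i => Reducible.of_neutralG (.var i)
  rw [TmG.subst_id] at h
  exact h.hasNormalForm
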